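/- Let ω = (−1 + i√3)/2 and let Q be the 9×9 matrix with rows (0, 1, 1, 1, 1, 1, 1, 1, 1), (1, 0, 1, ω, ω, ω, ω², ω², ω²), (1, 1, 0, ω², ω², ω², ω, ω, ω), (1, ω², ω, 0, ω, ω², 1, ω, ω²), (1, ω², ω, ω², 0, ω, ω, ω², 1), (1, ω², ω, ω, ω², 0, ω², 1, ω), (1, ω, ω², 1, ω², ω, 0, ω², ω), (1, ω, ω², ω², ω, 1, ω, 0, ω²), (1, ω, ω², ω, 1, ω², ω², ω, 0). If Q' is any 9×9 cube root Seidel matrix satisfying Q'² = 8·I − 2·Q', then Q' is switching equivalent to Q: there exist a permutation σ of the index set {1,…,9} and complex numbers d_1, …, d_9 with |d_i| = 1 for all i such that Q'_{ij} = d_i · Q_{σ(i)σ(j)} · conj(d_j) for all i, j. -/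

import Mathlib

/-- `ω = (−1 + i√3)/2`, a primitive cube root of unity. -/
noncomputable def ω3 : ℂ := (-1 + Complex.I * Real.sqrt 3) / 2

/-- A cube root Seidel matrix: self-adjoint, zero diagonal, off-diagonal
entries among the cube roots of unity. -/
def IsCubeRootSeidel {n : ℕ} (Q : Matrix (Fin n) (Fin n) ℂ) : Prop :=
  Q.IsHermitian ∧ (∀ i, Q i i = 0) ∧
    ∀ i j, i ≠ j → Q i j = 1 ∨ Q i j = ω3 ∨ Q i j = ω3 ^ 2

/-- The 9×9 cube root signature matrix of an equiangular (9,6)-frame. -/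
noncomputable def Q9 : Matrix (Fin 9) (Fin 9) ℂ :=
  !![0, 1, 1, 1, 1, 1, 1, 1, 1;
     1, 0, 1, ω3, ω3, ω3, ω3 ^ 2, ω3 ^ 2, ω3 ^ 2;
     1, 1, 0, ω3 ^ 2, ω3 ^ 2, ω3 ^ 2, ω3, ω3, ω3;
     1, ω3 ^ 2, ω3, 0, ω3, ω3 ^ 2, 1, ω3, ω3 ^ 2;
     1, ω3 ^ 2, ω3, ω3 ^ 2, 0, ω3, ω3, ω3 ^ 2, 1;
     1, ω3 ^ 2, ω3, ω3, ω3 ^ 2, 0, ω3 ^ 2, 1, ω3;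
     1, ω3, ω3 ^ 2, 1, ω3 ^ 2, ω3, 0, ω3 ^ 2, ω3;
     1, ω3, ω3 ^ 2, ω3 ^ 2, ω3, 1, ω3, 0, ω3 ^ 2;
     1, ω3, ω3 ^ 2, ω3, 1, ω3 ^ 2, ω3 ^ 2, ω3, 0]

/-! ### The exponent of a cube root Seidel matrix -/

/-- The character `a ↦ ω ^ a` of `ZMod 3`. -/
noncomputable def cubeChar (a : ZMod 3) : ℂ := ω3 ^ a.val

lemma ω3_sq : ω3 ^ 2 = -1 - ω3 := by
  have h : ((Real.sqrt 3 : ℝ) : ℂ) ^ 2 = 3 := by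
    rw [← Complex.ofReal_pow, Real.sq_sqrt (by norm_num)]
    norm_num
  unfold ω3
  linear_combination (1 / 4) * Complex.I ^ 2 * h + (3 / 4) * Complex.I_sq

lemma ω3_cube : ω3 ^ 3 = 1 := by
  linear_combination (ω3 - 1) * ω3_sq

lemma conj_ω3 : (starRingEnd ℂ) ω3 = ω3 ^ 2 := by
  rw [ω3_sq]
  simp only [ω3, map_div₀, map_add, map_mul, map_neg, map_one, Complex.conj_I,
    Complex.conj_ofReal, map_ofNat]
  ring

lemma cubeChar_zero : cubeChar 0 = 1 := by simp [cubeChar]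

lemma cubeChar_one : cubeChar 1 = ω3 := by
  rw [cubeChar, show (1 : ZMod 3).val = 1 from rfl, pow_one]

lemma cubeChar_two : cubeChar 2 = ω3 ^ 2 := rfl

lemma cubeChar_add (a b : ZMod 3) : cubeChar (a + b) = cubeChar a * cubeChar b := by
  rw [cubeChar, cubeChar, cubeChar, ← pow_add, ZMod.val_add]
  exact (pow_eq_pow_mod _ ω3_cube).symm

lemma conj_cubeChar (a : ZMod 3) : (starRingEnd ℂ) (cubeChar a) = cubeChar (-a) := by
  have h : ω3 ^ 4 = ω3 := by linear_combination ω3 * ω3_cube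
  obtain rfl | rfl | rfl : a = 0 ∨ a = 1 ∨ a = 2 := by revert a; decide
  · simp [cubeChar]
  · change (starRingEnd ℂ) (ω3 ^ 1) = ω3 ^ 2
    rw [pow_one, conj_ω3]
  · change (starRingEnd ℂ) (ω3 ^ 2) = ω3 ^ 1
    rw [map_pow, conj_ω3, pow_one, ← pow_mul, h]

lemma norm_cubeChar (a : ZMod 3) : ‖cubeChar a‖ = 1 := by
  rw [cubeChar, norm_pow, Complex.norm_eq_one_of_pow_eq_one ω3_cube (by norm_num), one_pow]

lemma re_cubeChar (a : ZMod 3) : (cubeChar a).re = if a = 0 then 1 else -1 / 2 := by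
  have h : ω3.re = -1 / 2 := by simp [ω3]
  obtain rfl | rfl | rfl : a = 0 ∨ a = 1 ∨ a = 2 := by revert a; decide
  · simp [cubeChar]
  · change (ω3 ^ 1).re = -1 / 2
    rw [pow_one, h]
  · change (ω3 ^ 2).re = -1 / 2
    rw [ω3_sq, Complex.sub_re, h]
    norm_num

lemma cubeChar_injective : Function.Injective cubeChar := by
  have key (c : ZMod 3) (h : cubeChar c = 1) : c = 0 := by
    by_contra hc
    have := re_cubeChar c
    rw [h, if_neg hc] at this
    norm_num at this
  intro a b hab
  rw [← sub_eq_zero]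
  apply key
  rw [sub_eq_add_neg, cubeChar_add, hab, ← cubeChar_add, add_neg_cancel, cubeChar_zero]

/-- A sum of seven cube roots of unity equal to `-2` contains exactly one `1`. -/
lemma card_filter_eq_zero_of_sum_cubeChar {ι : Type*} (s : Finset ι) (g : ι → ZMod 3)
    (hs : s.card = 7) (hsum : ∑ k ∈ s, cubeChar (g k) = -2) :
    (s.filter fun k => g k = 0).card = 1 := by
  have h := congrArg Complex.re hsum
  have hsplit (k : ι) : (cubeChar (g k)).re = (3 / 2) * (if g k = 0 then 1 else 0) - 1 / 2 := by
    rw [re_cubeChar]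
    split_ifs <;> norm_num
  rw [Complex.re_sum, Finset.sum_congr rfl fun k _ => hsplit k, Finset.sum_sub_distrib,
    ← Finset.mul_sum, Finset.sum_boole, Finset.sum_const, hs] at h
  norm_num at h
  have h' : ((s.filter fun k => g k = 0).card : ℝ) = 1 := by linarith
  exact_mod_cast h'

/-- The exponents of the entries of `Q9`. -/
def Q9Exponent : Fin 9 → Fin 9 → ZMod 3 :=
  ![![0, 0, 0, 0, 0, 0, 0, 0, 0],
    ![0, 0, 0, 1, 1, 1, 2, 2, 2],
    ![0, 0, 0, 2, 2, 2, 1, 1, 1],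
    ![0, 2, 1, 0, 1, 2, 0, 1, 2],
    ![0, 2, 1, 2, 0, 1, 1, 2, 0],
    ![0, 2, 1, 1, 2, 0, 2, 0, 1],
    ![0, 1, 2, 0, 2, 1, 0, 2, 1],
    ![0, 1, 2, 2, 1, 0, 1, 0, 2],
    ![0, 1, 2, 1, 0, 2, 2, 1, 0]]

lemma Q9_apply (i j : Fin 9) : Q9 i j = if i = j then 0 else cubeChar (Q9Exponent i j) := by
  fin_cases i <;> fin_cases j <;>
    first
    | rfl
    | exact cubeChar_zero.symm
    | exact cubeChar_one.symm

lemma IsCubeRootSeidel.exists_exponent {n : ℕ} {Q : Matrix (Fin n) (Fin n) ℂ}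
    (hQ : IsCubeRootSeidel Q) :
    ∃ e : Fin n → Fin n → ZMod 3, (∀ i j, e i j = -e j i) ∧
      ∀ i j, Q i j = if i = j then 0 else cubeChar (e i j) := by
  obtain ⟨hherm, hdiag, hoff⟩ := hQ
  have h (i j : Fin n) : ∃ a : ZMod 3, (i = j → a = 0) ∧ (i ≠ j → Q i j = cubeChar a) := by
    by_cases hij : i = j
    · exact ⟨0, fun _ => rfl, fun h => absurd hij h⟩
    · rcases hoff i j hij with h | h | h
      · exact ⟨0, fun h => absurd h hij, fun _ => h.trans cubeChar_zero.symm⟩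
      · exact ⟨1, fun h => absurd h hij, fun _ => h.trans cubeChar_one.symm⟩
      · exact ⟨2, fun h => absurd h hij, fun _ => h⟩
  choose e he₀ he using h
  refine ⟨e, fun i j => ?_, fun i j => ?_⟩
  · by_cases hij : i = j
    · subst hij
      rw [he₀ i i rfl, neg_zero]
    · apply cubeChar_injective
      rw [← conj_cubeChar, ← he i j hij, ← he j i (Ne.symm hij)]
      exact (hherm.apply i j).symm
  · split_ifs with hij
    · rw [hij, hdiag]
    · exact he i j hij

/-- In a `9 × 9` cube root Seidel matrix with `Q ^ 2 = 8 - 2 Q`, the triples of indices with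
trivial triple product form a Steiner triple system. -/
lemma existsUnique_triple {Q : Matrix (Fin 9) (Fin 9) ℂ} {e : Fin 9 → Fin 9 → ZMod 3}
    (hanti : ∀ i j, e i j = -e j i) (he : ∀ i j, Q i j = if i = j then 0 else cubeChar (e i j))
    (heq : Q ^ 2 = (8 : ℂ) • (1 : Matrix (Fin 9) (Fin 9) ℂ) - (2 : ℂ) • Q)
    {i j : Fin 9} (hij : i ≠ j) :
    ∃! k, k ≠ i ∧ k ≠ j ∧ e i j + e j k + e k i = 0 := by
  have hone : cubeChar (e i j) * cubeChar (e j i) = 1 := by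
    rw [hanti i j, ← cubeChar_add, neg_add_cancel, cubeChar_zero]
  have hentry : ∑ k, Q j k * Q k i = -2 * cubeChar (e j i) := by
    have := congrFun (congrFun heq j) i
    rw [pow_two, Matrix.mul_apply] at this
    rw [this]
    simp [he, hij.symm]
  have hsum : ∑ k ∈ ({i, j} : Finset (Fin 9))ᶜ, cubeChar (e i j + e j k + e k i) = -2 := by
    calc ∑ k ∈ ({i, j} : Finset (Fin 9))ᶜ, cubeChar (e i j + e j k + e k i)
        = ∑ k ∈ ({i, j} : Finset (Fin 9))ᶜ, cubeChar (e i j) * (Q j k * Q k i) := by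
          refine Finset.sum_congr rfl fun k hk => ?_
          simp only [Finset.mem_compl, Finset.mem_insert, Finset.mem_singleton, not_or] at hk
          rw [he j k, he k i, if_neg (Ne.symm hk.2), if_neg hk.1, cubeChar_add, cubeChar_add,
            mul_assoc]
      _ = ∑ k, cubeChar (e i j) * (Q j k * Q k i) := by
          refine Finset.sum_subset (Finset.subset_univ _) fun k _ hk => ?_
          simp only [Finset.mem_compl, Finset.mem_insert, Finset.mem_singleton, not_not] at hk
          rcases hk with rfl | rfl <;> simp [he]
      _ = -2 := by
          rw [← Finset.mul_sum, hentry]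
          linear_combination (-2) * hone
  have hcard : (({i, j} : Finset (Fin 9))ᶜ).card = 7 := by
    rw [Finset.card_compl, Finset.card_pair hij, Fintype.card_fin]
  obtain ⟨k, hk⟩ := Finset.card_eq_one.mp (card_filter_eq_zero_of_sum_cubeChar _ _ hcard hsum)
  simp only [Finset.ext_iff, Finset.mem_filter, Finset.mem_compl, Finset.mem_insert,
    Finset.mem_singleton, not_or, and_assoc] at hk
  exact ⟨k, (hk k).mpr rfl, fun l hl => (hk l).mp hl⟩

/-! ### Uniqueness of the triple products -/

section Labelling

variable {ι : Type*} {f : ι → ι → ZMod 3} {o : ι}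

lemma diag_eq_zero_of_antisymm (hanti : ∀ i j, f i j = -f j i) (i : ι) : f i i = 0 := by
  have h : ∀ x : ZMod 3, x = -x → x = 0 := by decide
  exact h _ (hanti i i)

/-- If `{i, j, k}` is a line avoiding the base point `o`, the three areas seen from `o` agree. -/
lemma eq_of_line (hanti : ∀ i j, f i j = -f j i) (hbase : ∀ i, f o i = 0)
    (hex : ∀ i j, i ≠ j → ∃! k, k ≠ i ∧ k ≠ j ∧ f i j + f j k + f k i = 0)
    {i j k : ι} (hki : k ≠ i) (hkj : k ≠ j) (hline : f i j + f j k + f k i = 0)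
    (hij : f i j ≠ 0) : f j k = f i j ∧ f k i = f i j := by
  have hbase' (l : ι) : f l o = 0 := by rw [hanti, hbase, neg_zero]
  have hself := diag_eq_zero_of_antisymm hanti
  have hne : i ≠ j := fun h => hij (by rw [h, hself])
  have hio : i ≠ o := fun h => hij (by rw [h, hbase])
  have hjo : j ≠ o := fun h => hij (by rw [h, hbase'])
  have hko : k ≠ o := by
    rintro rfl
    exact hij (by simpa [hbase, hbase'] using hline)
  have hjk : f j k ≠ 0 := fun h => hio <| (hex j k hkj.symm).unique
    ⟨hne, hki.symm, by rw [← hline]; ring⟩ ⟨hjo.symm, hko.symm, by simp [h, hbase, hbase']⟩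
  have hik : f k i ≠ 0 := fun h => hjo <| (hex k i hki).unique
    ⟨hkj.symm, hne.symm, by rw [← hline]; ring⟩ ⟨hko.symm, hio.symm, by simp [h, hbase, hbase']⟩
  have key : ∀ x y z : ZMod 3, x ≠ 0 ∧ y ≠ 0 ∧ z ≠ 0 ∧ x + y + z = 0 → y = x ∧ z = x := by
    decide
  exact key _ _ _ ⟨hij, hjk, hik, hline⟩

/-- Two points collinear with the base point `o` see any further point under opposite areas. -/
lemma eq_neg_of_line (hanti : ∀ i j, f i j = -f j i) (hbase : ∀ i, f o i = 0)
    (hex : ∀ i j, i ≠ j → ∃! k, k ≠ i ∧ k ≠ j ∧ f i j + f j k + f k i = 0)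
    {i k l : ι} (hko : k ≠ o) (hki : k ≠ i) (hik : f i k = 0) (hil : f i l ≠ 0) :
    f k l = -f i l := by
  have hbase' (l : ι) : f l o = 0 := by rw [hanti, hbase, neg_zero]
  have hio : i ≠ o := fun h => hil (by rw [h, hbase])
  have hlo : l ≠ o := fun h => hil (by rw [h, hbase'])
  have hli : l ≠ i := fun h => hil (by rw [h, diag_eq_zero_of_antisymm hanti])
  have hlk : l ≠ k := fun h => hil (by rw [h, hik])
  have hkl : f k l ≠ 0 := fun h => hli <| (hex o k hko.symm).unique
    ⟨hlo, hlk, by simp [h, hbase, hbase']⟩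
    ⟨hio, hki.symm, by rw [hanti k i, hik]; simp [hbase, hbase']⟩
  have hT : f i k + f k l + f l i ≠ 0 := fun h => hlo <| (hex i k hki.symm).unique
    ⟨hli, hlk, h⟩ ⟨hio.symm, hko.symm, by simp [hik, hbase, hbase']⟩
  rw [hik, hanti l i] at hT
  have key : ∀ x y : ZMod 3, x ≠ 0 ∧ y ≠ 0 ∧ 0 + y + -x ≠ 0 → y = -x := by decide
  exact key _ _ ⟨hil, hkl, hT⟩

/-- A Steiner triple system whose lines are the zeros of an area form with values in `ZMod 3`
contains a labelled copy of the affine plane of order three. -/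
lemma exists_labelling (hanti : ∀ i j, f i j = -f j i) (hbase : ∀ i, f o i = 0)
    (hex : ∀ i j, i ≠ j → ∃! k, k ≠ i ∧ k ≠ j ∧ f i j + f j k + f k i = 0)
    {a b : ι} (hab : f a b = 1) :
    ∃ p : Fin 9 → ι, ∀ i j, f (p i) (p j) = Q9Exponent i j := by
  have hbase' (l : ι) : f l o = 0 := by rw [hanti, hbase, neg_zero]
  have hself := diag_eq_zero_of_antisymm hanti
  have hthird (i : ι) (hi : i ≠ o) : ∃ k, k ≠ o ∧ k ≠ i ∧ f i k = 0 := by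
    obtain ⟨k, ⟨hko, hki, h⟩, -⟩ := hex o i hi.symm
    exact ⟨k, hko, hki, by simpa [hbase, hbase'] using h⟩
  have hne {i j : ι} (h : f i j ≠ 0) : i ≠ o ∧ j ≠ o ∧ i ≠ j := by
    refine ⟨?_, ?_, ?_⟩ <;> rintro rfl <;> simp only [hbase, hbase', hself] at h <;> exact h rfl
  have hneg {i k l : ι} (hk : k ≠ o ∧ k ≠ i ∧ f i k = 0) (hil : f i l ≠ 0) : f k l = -f i l :=
    eq_neg_of_line hanti hbase hex hk.1 hk.2.1 hk.2.2 hil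
  have hcol {i j k : ι} (hk : k ≠ i ∧ k ≠ j ∧ f i j + f j k + f k i = 0) (hij : f i j ≠ 0) :
      f j k = f i j ∧ f k i = f i j :=
    eq_of_line hanti hbase hex hk.1 hk.2.1 hk.2.2 hij
  have h10 : (1 : ZMod 3) ≠ 0 := by decide
  have h20 : (2 : ZMod 3) ≠ 0 := by decide
  have hneg1 : -(1 : ZMod 3) = 2 := by decide
  have hneg2 : -(2 : ZMod 3) = 1 := by decide
  have flip1 {i j : ι} (h : f i j = 1) : f j i = 2 := by rw [hanti, h, hneg1]
  have flip2 {i j : ι} (h : f i j = 2) : f j i = 1 := by rw [hanti, h, hneg2]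
  have flip0 {i j : ι} (h : f i j = 0) : f j i = 0 := by rw [hanti, h, neg_zero]
  have neg1 {i k l : ι} (hk : k ≠ o ∧ k ≠ i ∧ f i k = 0) (hil : f i l = 1) : f k l = 2 := by
    rw [hneg hk (hil ▸ h10), hil, hneg1]
  have neg2 {i k l : ι} (hk : k ≠ o ∧ k ≠ i ∧ f i k = 0) (hil : f i l = 2) : f k l = 1 := by
    rw [hneg hk (hil ▸ h20), hil, hneg2]
  -- The labels are `o, a, c, b, p₄, p₅, p₆, p₇, p₈`, in this order.
  have ha := hne (hab ▸ h10)
  obtain ⟨c, hc⟩ := hthird a ha.1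
  obtain ⟨p₆, h₆⟩ := hthird b ha.2.1
  have ha6 : f a p₆ = 2 := flip1 (neg2 h₆ (flip1 hab))
  obtain ⟨p₇, h₇, -⟩ := hex a b ha.2.2
  obtain ⟨hb7, h7a⟩ := hcol h₇ (hab ▸ h10)
  rw [hab] at hb7 h7a
  have ha7 := flip1 h7a
  obtain ⟨p₄, h₄, -⟩ := hex a p₆ (hne (ha6 ▸ h20)).2.2
  obtain ⟨h64, h4a⟩ := hcol h₄ (ha6 ▸ h20)
  rw [ha6] at h64 h4a
  have ha4 := flip2 h4a
  obtain ⟨p₈, h₈⟩ := hthird p₄ (hne (h4a ▸ h20)).1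
  obtain ⟨p₅, h₅⟩ := hthird p₇ (hne (h7a ▸ h10)).1
  have ha8 := flip1 (neg2 h₈ h4a)
  have ha5 := flip2 (neg1 h₅ h7a)
  have hb5 := flip1 (neg2 h₅ (flip1 hb7))
  have h68 := flip2 (neg1 h₈ (flip2 h64))
  have h67 := neg1 h₆ hb7
  have h65 := neg2 h₆ hb5
  have h₆' : b ≠ o ∧ b ≠ p₆ ∧ f p₆ b = 0 := ⟨ha.2.1, h₆.2.1.symm, flip0 h₆.2.2⟩
  have hb4 := neg2 h₆' h64
  have hb8 := neg1 h₆' h68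
  have h47 : f p₄ p₇ = 2 := by
    have h0 : f p₄ p₇ ≠ 0 := fun h => by
      have h74 : p₇ ≠ p₄ := by
        rintro rfl
        exact absurd (ha7.symm.trans ha4) (by decide)
      have h78 : p₇ = p₈ := (hex o p₄ (hne (h4a ▸ h20)).1.symm).unique
        ⟨(hne (h7a ▸ h10)).1, h74, by simp [h, hbase, hbase']⟩
        ⟨h₈.1, h₈.2.1, by simp [h₈.2.2, hbase, hbase']⟩
      rw [h78, hb8] at hb7
      exact absurd hb7 (by decide)
    have h1 : f p₄ p₇ ≠ 1 := fun h => by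
      have h76 : p₇ = p₆ := (hex a p₄ h₄.1.symm).unique
        ⟨h₇.1, (hne h0).2.2.symm, by rw [ha4, h, h7a]; decide⟩
        ⟨(hne (ha6 ▸ h20)).2.2.symm, h₄.2.1.symm, by rw [ha4, flip2 h64, flip2 ha6]; decide⟩
      rw [h76, h₆.2.2] at hb7
      exact absurd hb7 (by decide)
    generalize f p₄ p₇ = x at h0 h1
    revert x
    decide
  have h87 := neg2 h₈ h47
  have h45 := flip2 (neg1 h₅ (flip2 h47))
  have h58 := neg2 h₅ (flip1 h87)
  have upper : ∀ i j, i < j → f (![o, a, c, b, p₄, p₅, p₆, p₇, p₈] i)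
      (![o, a, c, b, p₄, p₅, p₆, p₇, p₈] j) = Q9Exponent i j := by
    intro i j hij
    fin_cases i <;> fin_cases j <;>
      first
      | exact absurd hij (by decide)
      | exact hbase _
      | assumption
      | exact hc.2.2
      | exact h₆.2.2
      | exact h₈.2.2
      | exact flip0 h₅.2.2
      | exact neg1 hc ‹_›
      | exact neg2 hc ‹_›
      | exact flip1 ‹_›
      | exact flip2 ‹_›
  have hq : ∀ i j, Q9Exponent i j = -Q9Exponent j i := by decide
  refine ⟨![o, a, c, b, p₄, p₅, p₆, p₇, p₈], fun i j => ?_⟩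
  rcases lt_trichotomy i j with hij | rfl | hij
  · exact upper i j hij
  · have hdiag : ∀ i, Q9Exponent i i = 0 := by decide
    rw [hself, hdiag]
  · rw [hanti, upper j i hij, ← hq]

end Labelling

theorem Q9_unique_up_to_switching
    (Q' : Matrix (Fin 9) (Fin 9) ℂ) (hQ' : IsCubeRootSeidel Q')
    (heq : Q' ^ 2 = (8 : ℂ) • (1 : Matrix (Fin 9) (Fin 9) ℂ) - (2 : ℂ) • Q') :
    ∃ (σ : Equiv.Perm (Fin 9)) (d : Fin 9 → ℂ), (∀ i, ‖d i‖ = 1) ∧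
      ∀ i j, Q' i j = d i * Q9 (σ i) (σ j) * (starRingEnd ℂ) (d j) := by
  obtain ⟨e, hanti, he⟩ := hQ'.exists_exponent
  obtain ⟨p, hp⟩ : ∃ p : Fin 9 → Fin 9,
      ∀ i j, e 0 (p i) + e (p i) (p j) + e (p j) 0 = Q9Exponent i j := by
    let f (i j : Fin 9) : ZMod 3 := e 0 i + e i j + e j 0
    have hfanti (i j : Fin 9) : f i j = -f j i := by
      simp only [f]
      rw [hanti 0 i, hanti i j, hanti j 0]
      ring
    have hbase (i : Fin 9) : f 0 i = 0 := by
      simp only [f]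
      have h : e 0 0 = 0 := diag_eq_zero_of_antisymm hanti 0
      rw [h, hanti i 0]
      ring
    have hex (i j : Fin 9) (hij : i ≠ j) :
        ∃! k, k ≠ i ∧ k ≠ j ∧ f i j + f j k + f k i = 0 := by
      have h (k : Fin 9) : f i j + f j k + f k i = e i j + e j k + e k i := by
        simp only [f]
        rw [hanti 0 i, hanti 0 j, hanti 0 k]
        ring
      simp only [h]
      exact existsUnique_triple hanti he heq hij
    obtain ⟨b, hb⟩ : ∃ b, f 1 b ≠ 0 := by
      by_contra! h
      have hk (k : Fin 9) : f 0 1 + f 1 k + f k 0 = 0 := by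
        rw [hbase, h, hfanti, hbase, neg_zero, add_zero, add_zero]
      exact absurd ((hex 0 1 (by decide)).unique
        ⟨by decide, by decide, hk 2⟩ ⟨by decide, by decide, hk 3⟩) (by decide)
    obtain ⟨i, j, hij⟩ : ∃ i j, f i j = 1 := by
      have h : ∀ x : ZMod 3, x ≠ 0 → x = 1 ∨ -x = 1 := by decide
      rcases h _ hb with h | h
      · exact ⟨1, b, h⟩
      · exact ⟨b, 1, by rw [hfanti, h]⟩
    exact exists_labelling hfanti hbase hex hij
  have hinj : Function.Injective p := by
    have hrows : ∀ i j, (∀ k, Q9Exponent i k = Q9Exponent j k) → i = j := by decide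
    exact fun i j hij => hrows i j fun k => by rw [← hp, ← hp, hij]
  let σ : Equiv.Perm (Fin 9) := (Equiv.ofBijective p hinj.bijective_of_finite).symm
  have hσ (i : Fin 9) : p (σ i) = i := Equiv.ofBijective_apply_symm_apply p _ i
  refine ⟨σ, fun i => cubeChar (e i 0), fun i => norm_cubeChar _, fun i j => ?_⟩
  rw [he, Q9_apply]
  by_cases hij : i = j
  · simp [hij]
  · rw [if_neg hij, if_neg (σ.injective.ne hij), conj_cubeChar, ← cubeChar_add,
      ← cubeChar_add, ← hp, hσ, hσ, hanti 0 i]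
    congr 1
    ring
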